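/- Fix 0 < q < 1, θ = π/4, and t ∈ ℝ. With λ_x, μ_x the positive reals of the elliptic parametrisation, define z(u) = −θ1(u+θ)/θ1(u−θ), ε(u) = −2 (θ1(θ)/θ1(2θ))² · θ1(u)²/(θ1(u−θ)θ1(u+θ)), and A_x(u) = λ_x · θ4(t−u+(2x−1)θ)/θ4(t+(2x−1)θ). Then for every integer x and every u ∈ ℂ with θ1(u−θ) ≠ 0 and θ1(u+θ) ≠ 0, the one-particle recursion holds: (ε(u) + λ_{x+1}²) A_x(u) = λ_x λ_{x+1} (μ_{x+1}² z(u) + μ_x² z(u)⁻¹) A_{x+1}(u). -/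

import Mathlib

/-- The Jacobi theta function `θ₁(u,q) = −i Σ_{j∈ℤ} (−1)^j q^{(j+1/2)²} e^{(2j+1)iu}`. -/
noncomputable def th1 (q u : ℂ) : ℂ :=
  -Complex.I * ∑' j : ℤ, (-1 : ℂ) ^ j * q ^ (((j : ℂ) + 1 / 2) ^ 2) *
    Complex.exp ((2 * (j : ℂ) + 1) * Complex.I * u)

/-- The Jacobi theta function `θ₄(u,q) = Σ_{j∈ℤ} (−1)^j q^{j²} e^{2iju}`. -/
noncomputable def th4 (q u : ℂ) : ℂ :=
  ∑' j : ℤ, (-1 : ℂ) ^ j * q ^ ((j : ℂ) ^ 2) * Complex.exp (2 * (j : ℂ) * Complex.I * u)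

/-- `θ = π/4`. -/
noncomputable def thet : ℂ := (Real.pi : ℂ) / 4

/-- The elliptic rapidity `z(u) = −θ₁(u+θ)/θ₁(u−θ)`. -/
noncomputable def zrap (q u : ℂ) : ℂ := -th1 q (u + thet) / th1 q (u - thet)

/-- The single-particle excitation energy of the staggered M₂ model. -/
noncomputable def eps (q u : ℂ) : ℂ :=
  -2 * (th1 q thet / th1 q (2 * thet)) ^ 2 * th1 q u ^ 2 /
    (th1 q (u - thet) * th1 q (u + thet))

/-- The periodic part `A_x(u) = λ_x θ₄(t−u+(2x−1)θ)/θ₄(t+(2x−1)θ)` of the Bloch wave. -/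
noncomputable def Afun (q t : ℝ) (lam : ℤ → ℝ) (x : ℤ) (u : ℂ) : ℂ :=
  (lam x : ℂ) * th4 (q : ℂ) ((t : ℂ) - u + (2 * (x : ℂ) - 1) * thet) /
    th4 (q : ℂ) ((t : ℂ) + (2 * (x : ℂ) - 1) * thet)

open Complex

/-- The Gaussian sum `Σ_{n∈ℤ} exp(L n² + b n)`. -/
noncomputable def gaussExpSum (L b : ℂ) : ℂ := ∑' n : ℤ, cexp (L * (n : ℂ) ^ 2 + b * n)

lemma summable_gaussExpSum {L : ℂ} (hL : L.re < 0) (b : ℂ) :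
    Summable fun n : ℤ => cexp (L * (n : ℂ) ^ 2 + b * n) := by
  have hpi : (Real.pi : ℂ) ≠ 0 := by exact_mod_cast Real.pi_ne_zero
  have hτ : 0 < (-I * L / Real.pi).im := by
    rw [div_ofReal_im]
    apply div_pos _ Real.pi_pos
    simpa using hL
  refine ((summable_jacobiTheta₂_term_iff (-I * b / (2 * Real.pi)) _).2 hτ).congr fun n => ?_
  rw [jacobiTheta₂_term]
  congr 1
  field_simp
  linear_combination (-(L * (n : ℂ) ^ 2 + b * n)) * I_sq

lemma gaussExpSum_add_two_pi_I (L b : ℂ) :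
    gaussExpSum L (b + 2 * Real.pi * I) = gaussExpSum L b := by
  refine tsum_congr fun n => ?_
  rw [show L * (n : ℂ) ^ 2 + (b + 2 * Real.pi * I) * n
    = L * (n : ℂ) ^ 2 + b * n + n * (2 * Real.pi * I) by ring, exp_add, exp_int_mul_two_pi_mul_I,
    mul_one]

lemma gaussExpSum_add_two_mul (L b : ℂ) :
    gaussExpSum L (b + 2 * L) = cexp (-L - b) * gaussExpSum L b := by
  rw [gaussExpSum, gaussExpSum, ← tsum_mul_left,
    ← (Equiv.addRight (1 : ℤ)).tsum_eq fun n : ℤ =>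
      cexp (-L - b) * cexp (L * (n : ℂ) ^ 2 + b * n)]
  refine tsum_congr fun n => ?_
  rw [← exp_add, Equiv.coe_addRight]
  push_cast
  ring_nf

/-- Pairs of integers, split by the parity of their sum. -/
lemma tsum_int_prod_eq_add {f : ℤ × ℤ → ℂ} (hf : Summable f) :
    ∑' p, f p = (∑' p : ℤ × ℤ, f (p.1 + p.2, p.1 - p.2))
      + ∑' p : ℤ × ℤ, f (p.1 + p.2 + 1, p.1 - p.2) := by
  let g₀ : ℤ × ℤ → ℤ × ℤ := fun p => (p.1 + p.2, p.1 - p.2)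
  let g₁ : ℤ × ℤ → ℤ × ℤ := fun p => (p.1 + p.2 + 1, p.1 - p.2)
  have h₀ : Function.Injective g₀ := fun p r h => by
    simp only [g₀, Prod.mk.injEq] at h
    ext <;> omega
  have h₁ : Function.Injective g₁ := fun p r h => by
    simp only [g₁, Prod.mk.injEq] at h
    ext <;> omega
  have hc : IsCompl (Set.range g₀) (Set.range g₁) := by
    constructor
    · rw [Set.disjoint_left]
      rintro _ ⟨p, rfl⟩ ⟨r, h⟩
      simp only [g₀, g₁, Prod.mk.injEq] at h
      omega
    · rw [codisjoint_iff_le_sup]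
      rintro ⟨m, n⟩ -
      rcases Int.even_or_odd' (m + n) with ⟨k, h | h⟩
      · exact Or.inl ⟨(k, m - k), by simp only [g₀, Prod.mk.injEq]; omega⟩
      · exact Or.inr ⟨(k, m - k - 1), by simp only [g₁, Prod.mk.injEq]; omega⟩
  refine HasSum.tsum_eq (HasSum.add_isCompl hc ?_ ?_)
  · exact h₀.hasSum_range_iff.2 (hf.comp_injective h₀).hasSum
  · exact h₁.hasSum_range_iff.2 (hf.comp_injective h₁).hasSum

lemma gaussExpSum_mul_gaussExpSum {L : ℂ} (hL : L.re < 0) (b c : ℂ) :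
    gaussExpSum L b * gaussExpSum L c =
      gaussExpSum (2 * L) (b + c) * gaussExpSum (2 * L) (b - c)
      + cexp (L + b) *
        (gaussExpSum (2 * L) (b + c + 2 * L) * gaussExpSum (2 * L) (b - c + 2 * L)) := by
  have hL2 : (2 * L).re < 0 := by rw [mul_re, re_ofNat, im_ofNat]; linarith
  have hs {L : ℂ} (hL : L.re < 0) (b : ℂ) := (summable_gaussExpSum hL b).norm
  simp only [gaussExpSum]
  rw [tsum_mul_tsum_of_summable_norm (hs hL b) (hs hL c),
    tsum_int_prod_eq_add (summable_mul_of_summable_norm (hs hL b) (hs hL c)),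
    tsum_mul_tsum_of_summable_norm (hs hL2 _) (hs hL2 _),
    tsum_mul_tsum_of_summable_norm (hs hL2 _) (hs hL2 _), ← tsum_mul_left]
  congr 1
  all_goals
    refine tsum_congr fun p => ?_
    simp only [← exp_add]
    push_cast
    ring_nf

/-- `Σ_{n∈ℤ} exp(2 L n² + 2inx)`, which is `θ₃(x, q²)` for `q = exp L`. -/
noncomputable def evenTheta (L x : ℂ) : ℂ := gaussExpSum (2 * L) (2 * I * x)

/-- `Σ_{n∈ℤ} exp(2 L (n+1/2)² + (2n+1)ix)`, which is `θ₂(x, q²)` for `q = exp L`. -/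
noncomputable def oddTheta (L x : ℂ) : ℂ :=
  cexp (L / 2 + I * x) * gaussExpSum (2 * L) (2 * I * x + 2 * L)

lemma evenTheta_add_pi (L x : ℂ) : evenTheta L (x + Real.pi) = evenTheta L x := by
  rw [evenTheta, evenTheta, ← gaussExpSum_add_two_pi_I _ (2 * I * x)]
  ring_nf

lemma oddTheta_add_pi (L x : ℂ) : oddTheta L (x + Real.pi) = -oddTheta L x := by
  rw [oddTheta, oddTheta, ← gaussExpSum_add_two_pi_I _ (2 * I * x + 2 * L),
    show L / 2 + I * (x + Real.pi) = L / 2 + I * x + Real.pi * I by ring, exp_add, exp_pi_mul_I]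
  ring_nf

lemma neg_one_zpow_eq_exp (n : ℤ) : (-1 : ℂ) ^ n = cexp (n * (Real.pi * I)) := by
  rw [exp_int_mul, exp_pi_mul_I]

lemma th4_eq_gaussExpSum {q : ℂ} (hq : q ≠ 0) (u : ℂ) :
    th4 q u = gaussExpSum (log q) (2 * I * u + Real.pi * I) := by
  refine tsum_congr fun n => ?_
  rw [neg_one_zpow_eq_exp, cpow_def_of_ne_zero hq, ← exp_add, ← exp_add]
  ring_nf

lemma th1_eq_gaussExpSum {q : ℂ} (hq : q ≠ 0) (u : ℂ) :
    th1 q u = -I * (cexp (log q / 4 + I * u) *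
      gaussExpSum (log q) (2 * I * u + Real.pi * I + log q)) := by
  rw [th1, gaussExpSum, ← tsum_mul_left (a := cexp _)]
  congr 1
  refine tsum_congr fun n => ?_
  rw [neg_one_zpow_eq_exp, cpow_def_of_ne_zero hq, ← exp_add, ← exp_add, ← exp_add]
  ring_nf

lemma th4_add_pi {q : ℂ} (hq : q ≠ 0) (u : ℂ) : th4 q (u + Real.pi) = th4 q u := by
  rw [th4_eq_gaussExpSum hq, th4_eq_gaussExpSum hq, ← gaussExpSum_add_two_pi_I _ (2 * I * u + _)]
  ring_nf

lemma th4_mul_th4 {q : ℂ} (hq : q ≠ 0) (hL : (log q).re < 0) (x y : ℂ) :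
    th4 q x * th4 q y = evenTheta (log q) (x + y) * evenTheta (log q) (x - y)
      - oddTheta (log q) (x + y) * oddTheta (log q) (x - y) := by
  rw [th4_eq_gaussExpSum hq, th4_eq_gaussExpSum hq, gaussExpSum_mul_gaussExpSum hL]
  simp only [evenTheta, oddTheta]
  generalize log q = L
  rw [show 2 * I * x + Real.pi * I + (2 * I * y + Real.pi * I)
      = 2 * I * (x + y) + 2 * Real.pi * I by ring,
    show 2 * I * (x + y) + 2 * Real.pi * I + 2 * L
      = 2 * I * (x + y) + 2 * L + 2 * Real.pi * I by ring,
    gaussExpSum_add_two_pi_I, gaussExpSum_add_two_pi_I,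
    show 2 * I * x + Real.pi * I - (2 * I * y + Real.pi * I) = 2 * I * (x - y) by ring,
    show L + (2 * I * x + Real.pi * I)
      = (L / 2 + I * (x + y)) + (L / 2 + I * (x - y)) + Real.pi * I by ring,
    exp_add, exp_add, exp_pi_mul_I]
  ring

lemma th1_mul_th1 {q : ℂ} (hq : q ≠ 0) (hL : (log q).re < 0) (x y : ℂ) :
    th1 q x * th1 q y = evenTheta (log q) (x + y) * oddTheta (log q) (x - y)
      - oddTheta (log q) (x + y) * evenTheta (log q) (x - y) := by
  have hG := gaussExpSum_mul_gaussExpSum hL (2 * I * x + Real.pi * I + log q)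
    (2 * I * y + Real.pi * I + log q)
  rw [th1_eq_gaussExpSum hq, th1_eq_gaussExpSum hq]
  simp only [evenTheta, oddTheta]
  generalize log q = L at *
  rw [show 2 * I * x + Real.pi * I + L + (2 * I * y + Real.pi * I + L)
      = 2 * I * (x + y) + 2 * L + 2 * Real.pi * I by ring,
    show 2 * I * (x + y) + 2 * L + 2 * Real.pi * I + 2 * L
      = 2 * I * (x + y) + 2 * (2 * L) + 2 * Real.pi * I by ring,
    gaussExpSum_add_two_pi_I, gaussExpSum_add_two_pi_I, gaussExpSum_add_two_mul,
    show 2 * I * x + Real.pi * I + L - (2 * I * y + Real.pi * I + L)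
      = 2 * I * (x - y) by ring] at hG
  have e₁ : cexp (L / 4 + I * x) * cexp (L / 4 + I * y) = cexp (L / 2 + I * (x + y)) := by
    rw [← exp_add]; ring_nf
  have e₂ : cexp (L / 2 + I * (x + y)) * cexp (L + (2 * I * x + Real.pi * I + L))
      * cexp (-(2 * L) - 2 * I * (x + y)) = -cexp (L / 2 + I * (x - y)) := by
    rw [← exp_add, ← exp_add, show L / 2 + I * (x + y) + (L + (2 * I * x + Real.pi * I + L))
      + (-(2 * L) - 2 * I * (x + y)) = L / 2 + I * (x - y) + Real.pi * I by ring, exp_add,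
      exp_pi_mul_I]
    ring
  set Gx := gaussExpSum L (2 * I * x + Real.pi * I + L)
  set Gy := gaussExpSum L (2 * I * y + Real.pi * I + L)
  set a := gaussExpSum (2 * L) (2 * I * (x + y))
  set d := gaussExpSum (2 * L) (2 * I * (x - y) + 2 * L)
  linear_combination (cexp (L / 4 + I * x) * cexp (L / 4 + I * y) * (Gx * Gy)) * I_sq
    - (Gx * Gy) * e₁ - cexp (L / 2 + I * (x + y)) * hG - a * d * e₂

/-- The three-term addition formula for `θ₁` and `θ₄`. -/
lemma th1_th4_three_term {q : ℂ} (hq : q ≠ 0) (hL : (log q).re < 0) (u v w : ℂ) :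
    th4 q w ^ 2 * (th1 q (u + v) * th1 q (u - v))
      - th1 q u ^ 2 * (th4 q (w + v) * th4 q (w - v))
      = -(th1 q v ^ 2 * (th4 q (w + u) * th4 q (w - u))) := by
  simp only [sq, th4_mul_th4 hq hL, th1_mul_th1 hq hL, sub_self]
  rw [show u + v + (u - v) = u + u by ring, show u + v - (u - v) = v + v by ring,
    show w + v + (w - v) = w + w by ring, show w + v - (w - v) = v + v by ring,
    show w + u + (w - u) = w + w by ring, show w + u - (w - u) = u + u by ring]
  ring

lemma th1_sq_mul_th4_mul_th4 {q : ℂ} (hq : q ≠ 0) (hL : (log q).re < 0) (u w : ℂ) :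
    th1 q (2 * thet) ^ 2 * (th4 q (w + u) * th4 q (w - u - 2 * thet))
      = th4 q (w + thet) ^ 2 * th1 q (u + thet) ^ 2
        + th4 q (w - thet) ^ 2 * th1 q (u - thet) ^ 2 := by
  simp only [sq, th4_mul_th4 hq hL, th1_mul_th1 hq hL, sub_self]
  have hθ : (Real.pi : ℂ) = 4 * thet := by rw [thet]; ring
  rw [show 2 * thet + 2 * thet = 0 + Real.pi by rw [hθ]; ring,
    show w + u + (w - u - 2 * thet) = w - thet + (w - thet) by ring,
    show w + u - (w - u - 2 * thet) = u - thet + (u - thet) + Real.pi by rw [hθ]; ring,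
    show w + thet + (w + thet) = w - thet + (w - thet) + Real.pi by rw [hθ]; ring,
    show u + thet + (u + thet) = u - thet + (u - thet) + Real.pi by rw [hθ]; ring]
  simp only [evenTheta_add_pi, oddTheta_add_pi]
  ring

/-- on the elliptic parametrisation, the one-particle recursion
`(ε(u) + λ_{x+1}²) A_x(u) = λ_x λ_{x+1} (μ_{x+1}² z(u) + μ_x² z(u)⁻¹) A_{x+1}(u)`
holds for every integer `x` and every `u` with `θ₁(u±θ) ≠ 0`. -/
theorem stmt8 (q t : ℝ) (hq : 0 < q) (hq1 : q < 1)
    (lam mu : ℤ → ℝ) (hlampos : ∀ x, 0 < lam x) (hmupos : ∀ x, 0 < mu x)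
    (hlam : ∀ x : ℤ, ((lam x : ℂ)) ^ 2 =
      2 * (th1 (q : ℂ) thet / th1 (q : ℂ) (2 * thet)) ^ 2 *
        th4 (q : ℂ) ((t : ℂ) + (2 * (x : ℂ) - 1) * thet) ^ 2 /
        (th4 (q : ℂ) ((t : ℂ) + 2 * ((x : ℂ) - 1) * thet) *
          th4 (q : ℂ) ((t : ℂ) + 2 * (x : ℂ) * thet)))
    (hmu : ∀ x : ℤ, ((mu x : ℂ)) ^ 2 =
      (th1 (q : ℂ) thet / th1 (q : ℂ) (2 * thet)) ^ 2 *
        th4 (q : ℂ) ((t : ℂ) + 2 * (x : ℂ) * thet) ^ 2 /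
        (th4 (q : ℂ) ((t : ℂ) + (2 * (x : ℂ) - 1) * thet) *
          th4 (q : ℂ) ((t : ℂ) + (2 * (x : ℂ) + 1) * thet)))
    (x : ℤ) (u : ℂ)
    (h1 : th1 (q : ℂ) (u - thet) ≠ 0) (h2 : th1 (q : ℂ) (u + thet) ≠ 0) :
    (eps (q : ℂ) u + ((lam (x + 1) : ℂ)) ^ 2) * Afun q t lam x u =
      (lam x : ℂ) * (lam (x + 1) : ℂ) *
        (((mu (x + 1) : ℂ)) ^ 2 * zrap (q : ℂ) u +
          ((mu x : ℂ)) ^ 2 * (zrap (q : ℂ) u)⁻¹) * Afun q t lam (x + 1) u := by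
  have hq0 : (q : ℂ) ≠ 0 := by exact_mod_cast hq.ne'
  have hL : (log (q : ℂ)).re < 0 := by
    rw [log_ofReal_re]
    exact Real.log_neg hq hq1
  have hθ : (Real.pi : ℂ) = 4 * thet := by rw [thet]; ring
  have hl := hlam (x + 1)
  have hm := hmu (x + 1)
  have hm' := hmu x
  have hl0 : (lam (x + 1) : ℂ) ^ 2 ≠ 0 := pow_ne_zero 2 (by exact_mod_cast (hlampos _).ne')
  have hm0 : (mu x : ℂ) ^ 2 ≠ 0 := pow_ne_zero 2 (by exact_mod_cast (hmupos _).ne')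
  obtain ⟨w, hw⟩ : ∃ w : ℂ, w = t + (2 * x + 1) * thet := ⟨_, rfl⟩
  have k1 := th1_th4_three_term hq0 hL u thet w
  have k2 := th1_sq_mul_th4_mul_th4 hq0 hL u w
  simp only [eps, zrap, Afun]
  push_cast at hl hm ⊢
  rw [show (t : ℂ) + (2 * (x + 1) - 1) * thet = w by rw [hw]; ring,
    show (t : ℂ) + 2 * (x + 1 - 1) * thet = w - thet by rw [hw]; ring,
    show (t : ℂ) + 2 * (x + 1) * thet = w + thet by rw [hw]; ring] at hl
  rw [show (t : ℂ) + (2 * (x + 1) - 1) * thet = w by rw [hw]; ring,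
    show (t : ℂ) + (2 * (x + 1) + 1) * thet = w - 2 * thet + Real.pi by rw [hw, hθ]; ring,
    show (t : ℂ) + 2 * (x + 1) * thet = w + thet by rw [hw]; ring, th4_add_pi hq0] at hm
  rw [← hw, show (t : ℂ) + (2 * x - 1) * thet = w - 2 * thet by rw [hw]; ring,
    show (t : ℂ) + 2 * x * thet = w - thet by rw [hw]; ring] at hm'
  rw [show (t : ℂ) + (2 * (x + 1) - 1) * thet = w by rw [hw]; ring,
    show (t : ℂ) - u + (2 * (x + 1) - 1) * thet = w - u by rw [hw]; ring,
    show (t : ℂ) + (2 * x - 1) * thet = w - 2 * thet by rw [hw]; ring,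
    show (t : ℂ) - u + (2 * x - 1) * thet = w - u - 2 * thet by rw [hw]; ring]
  rw [hl] at hl0
  rw [hm'] at hm0
  simp only [ne_eq, div_eq_zero_iff, mul_eq_zero, pow_eq_zero_iff, not_or, OfNat.ofNat_ne_zero,
    not_false_eq_true] at hl0 hm0
  obtain ⟨⟨⟨-, -, n2⟩, n3⟩, n4, n5⟩ := hl0
  obtain ⟨-, n6, -⟩ := hm0
  rw [hm, hm', show ∀ l a b c d : ℂ, l * a * b * (a * c / d) = a ^ 2 * (l * b * (c / d)) by
    intros; ring, hl]
  generalize th4 (q : ℂ) (w - u - 2 * thet) = Y at *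
  generalize th4 (q : ℂ) (w - u) = V at *
  generalize th4 (q : ℂ) (w - 2 * thet) = W at *
  generalize th1 (q : ℂ) (2 * thet) = D at *
  field_simp
  linear_combination th1 (q : ℂ) thet ^ 2 * lam x *
    (Y * D ^ 2 * k1 - th1 (q : ℂ) thet ^ 2 * V * k2)
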